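/- arXiv:2306.10389 — 9 statements merged into one kernel-verified Lean document; each statement's English description precedes it below -/
import Mathlib

section
/- Let K be a bicategory and let x, y, z be objects of K. Suppose given an adjunction ℓ ⊣ r where ℓ : y ⟶ x and r : x ⟶ y, with unit η : 𝟙_y ⟶ r ≫ ℓ and counit ε : ℓ ≫ ... (composite r then ℓ equal to the endo-1-cell of x), and an adjunction ℓ' ⊣ r' where ℓ' : y ⟶ z and r' : z ⟶ y. If the counit ε of ℓ ⊣ r is an invertible 2-cell, and the whiskered 2-cell obtained from the unit η, namely ℓ' whiskered on one side and r' on the other (the 2-cell r' ≫ ℓ' ⟶ (r' ≫ r ≫ ℓ) ≫ ℓ' induced by η, in pasting notation ℓ' η r' : ℓ'r' ⇒ ℓ'(rℓ)r'), is an invertible 2-cell, then the composite 1-cell r ≫ ℓ' : x ⟶ z is left adjoint to the composite 1-cell r' ≫ ℓ : z ⟶ x. -/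
open CategoryTheory CategoryTheory.Bicategory

universe w v u

/-- Lemma (reflection-compose-adjunction): given adjunctions `ℓ ⊣ r` and `ℓ' ⊣ r'` in a
bicategory, with `ℓ : y ⟶ x`, `r : x ⟶ y`, `ℓ' : y ⟶ z`, `r' : z ⟶ y`, such that the counit
`ε : r ≫ ℓ ⟶ 𝟙 x` is invertible and the whiskering of the unit `η : 𝟙 y ⟶ ℓ ≫ r` by `r'` and
`ℓ'` (the 2-cell `r' ≫ ℓ' ⟶ r' ≫ ((ℓ ≫ r) ≫ ℓ')`) is invertible, then `r ≫ ℓ' ⊣ r' ≫ ℓ`. -/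
theorem reflection_compose_adjunction {K : Type u} [Bicategory.{w, v} K] {x y z : K}
    (ℓ : y ⟶ x) (r : x ⟶ y) (adj : Bicategory.Adjunction ℓ r)
    (ℓ' : y ⟶ z) (r' : z ⟶ y) (adj' : Bicategory.Adjunction ℓ' r')
    (hε : IsIso adj.counit)
    (hη : IsIso (r' ◁ ((λ_ ℓ').inv ≫ adj.unit ▷ ℓ'))) :
    Nonempty (Bicategory.Adjunction (r ≫ ℓ') (r' ≫ ℓ)) := by
  obtain ⟨η, cu, tl, tr⟩ := adj
  obtain ⟨η', cu', tl', tr'⟩ := adj'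
  dsimp only at hε hη
  obtain ⟨δ, hδ1, hδ2⟩ := hε
  obtain ⟨τ, hτ1, hτ2⟩ := hη
  have e1 : δ ▷ r = 𝟙 _ ⊗≫ r ◁ η ⊗≫ 𝟙 _ := by
    calc δ ▷ r = 𝟙 _ ⊗≫ ((ρ_ r).hom ≫ (λ_ r).inv) ⊗≫ δ ▷ r := by bicategory
      _ = 𝟙 _ ⊗≫ r ◁ η ⊗≫ (cu ≫ δ) ▷ r := by rw [← tr]; bicategory
      _ = _ := by rw [hδ1]; bicategory
  have e2 : ℓ ◁ δ = 𝟙 _ ⊗≫ η ▷ ℓ ⊗≫ 𝟙 _ := by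
    calc ℓ ◁ δ = 𝟙 _ ⊗≫ ((λ_ ℓ).hom ≫ (ρ_ ℓ).inv) ⊗≫ ℓ ◁ δ := by bicategory
      _ = 𝟙 _ ⊗≫ η ▷ ℓ ⊗≫ ℓ ◁ (cu ≫ δ) := by rw [← tl]; bicategory
      _ = _ := by rw [hδ1]; bicategory
  refine ⟨⟨δ ⊗≫ r ◁ η' ▷ ℓ ⊗≫ 𝟙 _, 𝟙 _ ⊗≫ τ ⊗≫ cu', ?_, ?_⟩⟩
  · calc
      _ = 𝟙 _ ⊗≫ (δ ▷ r) ▷ ℓ' ⊗≫ r ◁ η' ▷ ((ℓ ≫ r) ≫ ℓ') ⊗≫ r ◁ ℓ' ◁ τ ⊗≫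
            r ◁ ℓ' ◁ cu' ⊗≫ 𝟙 _ := by
        dsimp only [leftZigzag]; bicategory
      _ = 𝟙 _ ⊗≫ r ◁ (𝟙 y ◁ (η ▷ ℓ') ≫ η' ▷ ((ℓ ≫ r) ≫ ℓ')) ⊗≫ r ◁ ℓ' ◁ τ ⊗≫
            r ◁ ℓ' ◁ cu' ⊗≫ 𝟙 _ := by
        rw [e1]; bicategory
      _ = 𝟙 _ ⊗≫ r ◁ η' ▷ ℓ' ⊗≫ r ◁ ℓ' ◁ ((r' ◁ ((λ_ ℓ').inv ≫ η ▷ ℓ')) ≫ τ) ⊗≫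
            r ◁ ℓ' ◁ cu' ⊗≫ 𝟙 _ := by
        rw [whisker_exchange]; bicategory
      _ = 𝟙 _ ⊗≫ r ◁ leftZigzag η' cu' ⊗≫ 𝟙 _ := by
        rw [hτ1]; bicategory
      _ = _ := by rw [tl']; bicategory
  · calc
      _ = 𝟙 _ ⊗≫ r' ◁ (ℓ ◁ δ) ⊗≫ r' ◁ (ℓ ≫ r) ◁ η' ▷ ℓ ⊗≫ τ ▷ r' ▷ ℓ ⊗≫
            cu' ▷ r' ▷ ℓ ⊗≫ 𝟙 _ := by
        dsimp only [rightZigzag]; bicategory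
      _ = 𝟙 _ ⊗≫ r' ◁ (η ▷ 𝟙 y ≫ (ℓ ≫ r) ◁ η') ▷ ℓ ⊗≫ τ ▷ r' ▷ ℓ ⊗≫
            cu' ▷ r' ▷ ℓ ⊗≫ 𝟙 _ := by
        rw [e2]; bicategory
      _ = 𝟙 _ ⊗≫ r' ◁ η' ▷ ℓ ⊗≫ ((r' ◁ ((λ_ ℓ').inv ≫ η ▷ ℓ')) ≫ τ) ▷ r' ▷ ℓ ⊗≫
            cu' ▷ r' ▷ ℓ ⊗≫ 𝟙 _ := by
        rw [← whisker_exchange]; bicategory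
      _ = 𝟙 _ ⊗≫ rightZigzag η' cu' ▷ ℓ ⊗≫ 𝟙 _ := by
        rw [hτ1]; bicategory
      _ = _ := by rw [tr']; bicategory
end

section
/- Let X, Y, Z be categories. Suppose given an adjunction L ⊣ R where L : Y ⥤ X and R : X ⥤ Y, with unit η : 𝟭_Y ⟶ L ⋙ R, such that the counit ε : R ⋙ L ⟶ 𝟭_X is a natural isomorphism; and an adjunction L' ⊣ R' where L' : Y ⥤ Z and R' : Z ⥤ Y. If for every object z of Z the morphism L'.map (η.app (R'.obj z)) : L'.obj (R'.obj z) ⟶ L'.obj (R.obj (L.obj (R'.obj z))) is an isomorphism, then the composite functor R ⋙ L' : X ⥤ Z is left adjoint to the composite functor R' ⋙ L : Z ⥤ X. -/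
open CategoryTheory

universe v₁ v₂ v₃ u₁ u₂ u₃

/-- Given adjunctions `L ⊣ R` (with `L : Y ⥤ X`) and `L' ⊣ R'` (with `L' : Y ⥤ Z`), if the
counit of `L ⊣ R` is a natural isomorphism and `L'.map (η.app (R'.obj z))` is an isomorphism
for every `z : Z`, then `R ⋙ L' ⊣ R' ⋙ L`. -/
theorem reflection_compose_adjunction_functors
    {X : Type u₁} {Y : Type u₂} {Z : Type u₃}
    [Category.{v₁} X] [Category.{v₂} Y] [Category.{v₃} Z]
    (L : Y ⥤ X) (R : X ⥤ Y) (adj : L ⊣ R)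
    (L' : Y ⥤ Z) (R' : Z ⥤ Y) (adj' : L' ⊣ R')
    (hε : IsIso adj.counit)
    (hη : ∀ z : Z, IsIso (L'.map (adj.unit.app (R'.obj z)))) :
    Nonempty ((R ⋙ L') ⊣ (R' ⋙ L)) := by
  have key : ∀ z : Z, IsIso (adj.unit.app (R'.obj z)) := by
    intro z
    have := hη z
    let r : R.obj (L.obj (R'.obj z)) ⟶ R'.obj z :=
      adj'.unit.app _ ≫ R'.map (inv (L'.map (adj.unit.app (R'.obj z))) ≫ adj'.counit.app z)
    have h1 : adj.unit.app (R'.obj z) ≫ r = 𝟙 (R'.obj z) := by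
      have h := adj'.unit.naturality (adj.unit.app (R'.obj z))
      dsimp at h
      dsimp only [r]
      rw [← Category.assoc]
      erw [h]
      rw [Category.assoc, ← R'.map_comp, IsIso.hom_inv_id_assoc]
      exact adj'.right_triangle_components z
    refine ⟨r, h1, ?_⟩
    let ff := adj.fullyFaithfulROfIsIsoCounit
    obtain ⟨g, hg⟩ := ff.map_surjective (r ≫ adj.unit.app (R'.obj z))
    have h2 : g = 𝟙 _ := by
      apply (adj.homEquiv _ _).injective
      rw [adj.homEquiv_unit, adj.homEquiv_unit, hg, R.map_id, ← Category.assoc, h1]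
      simp
    rw [← hg, h2, R.map_id]
    rfl
  let e : 𝟭 Z ⋙ R' ≅ (R' ⋙ L) ⋙ R :=
    NatIso.ofComponents (fun z => by
      have := key z
      exact asIso (adj.unit.app (R'.obj z))) (by intros; simp)
  exact ⟨adj'.restrictFullyFaithful adj.fullyFaithfulROfIsIsoCounit
    (Functor.FullyFaithful.id Z) (Functor.rightUnitor _).symm e⟩
end

section
/- Let A and B be locally small categories such that A has all small colimits, and let f : A ⥤ B be a functor. Then f has a right adjoint if and only if f preserves all small colimits and f is small-admissible. (Ulmer's adjoint functor theorem.) -/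
open CategoryTheory CategoryTheory.Limits

universe v u₁ u₂

/-- A functor `f : A ⥤ B` is small-admissible if, for every `b : B`, the presheaf
`B(f(−), b) = f.op ⋙ yoneda.obj b : Aᵒᵖ ⥤ Type v` is a small colimit of representables. -/
def SmallAdmissible {A : Type u₁} {B : Type u₂} [Category.{v} A] [Category.{v} B]
    (f : A ⥤ B) : Prop :=
  ∀ b : B, ∃ (J : Type v) (_ : SmallCategory J) (G : J ⥤ A),
    Nonempty ((f.op ⋙ yoneda.obj b) ≅ colimit (G ⋙ yoneda))

theorem ulmer_aux {A : Type u₁} {B : Type u₂}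
    [Category.{v} A] [Category.{v} B] [HasColimitsOfSize.{v, v} A] (f : A ⥤ B)
    [PreservesColimitsOfSize.{v, v} f] (b : B) (J : Type v) [SmallCategory J] (G : J ⥤ A)
    (i : (f.op ⋙ yoneda.obj b) ≅ colimit (G ⋙ yoneda)) :
    (f.op ⋙ yoneda.obj b).IsRepresentable := by
  let τ : ∀ j, yoneda.obj (G.obj j) ⟶ f.op ⋙ yoneda.obj b :=
    fun j => colimit.ι (G ⋙ yoneda) j ≫ i.inv
  have hτ : ∀ {j k : J} (g : j ⟶ k), yoneda.map (G.map g) ≫ τ k = τ j := by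
    intro j k g
    have := colimit.w (G ⋙ yoneda) g
    dsimp only [Functor.comp_map] at this
    simp only [τ, ← this, Category.assoc]
  let x : ∀ j, f.obj (G.obj j) ⟶ b := fun j => yonedaEquiv (τ j)
  have hx : ∀ {j k : J} (g : j ⟶ k), f.map (G.map g) ≫ x k = x j := by
    intro j k g
    have := yonedaEquiv_naturality (τ k) (G.map g)
    rw [hτ] at this
    exact this
  let c : Cocone (G ⋙ f) := { pt := b, ι := { app := x, naturality := fun j k g => by simpa using hx g } }
  let hX := isColimitOfPreserves f (colimit.isColimit G)
  let y : f.obj (colimit G) ⟶ b := hX.desc c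
  have hy : ∀ j, f.map (colimit.ι G j) ≫ y = x j := fun j => hX.fac c j
  let r : yoneda.obj (colimit G) ⟶ f.op ⋙ yoneda.obj b := yonedaEquiv.symm y
  have hr : ∀ j, yoneda.map (colimit.ι G j) ≫ r = τ j := by
    intro j
    apply yonedaEquiv.injective
    rw [← yonedaEquiv_naturality, Equiv.apply_symm_apply]
    exact hy j
  let q : f.op ⋙ yoneda.obj b ⟶ yoneda.obj (colimit G) :=
    i.hom ≫ colimit.desc (G ⋙ yoneda) (yoneda.mapCocone (colimit.cocone G))
  have hq : ∀ j, τ j ≫ q = yoneda.map (colimit.ι G j) := by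
    intro j
    simp [τ, q]
  have h1 : q ≫ r = 𝟙 _ := by
    rw [← cancel_epi i.inv]
    apply colimit.hom_ext
    intro j
    have : τ j ≫ q ≫ r = τ j := by rw [← Category.assoc, hq, hr]
    simpa [τ] using this
  have h2 : r ≫ q = 𝟙 _ := by
    obtain ⟨e, he⟩ := yoneda.map_surjective (r ≫ q)
    have : e = 𝟙 _ := by
      apply colimit.hom_ext
      intro j
      apply yoneda.map_injective
      rw [Functor.map_comp, he, ← Category.assoc, hr, hq, Category.comp_id]
    rw [← he, this, yoneda.map_id]
  exact ⟨colimit G, ⟨Functor.RepresentableBy.ofIso (Functor.RepresentableBy.yoneda _) ⟨r, q, h2, h1⟩⟩⟩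

/-- Ulmer's adjoint functor theorem: a functor `f` from a locally small category with all small
colimits has a right adjoint iff it preserves all small colimits and is small-admissible. -/
theorem ulmer_adjoint_functor_theorem {A : Type u₁} {B : Type u₂}
    [Category.{v} A] [Category.{v} B] [HasColimitsOfSize.{v, v} A] (f : A ⥤ B) :
    f.IsLeftAdjoint ↔ PreservesColimitsOfSize.{v, v} f ∧ SmallAdmissible f := by
  constructor
  · intro h
    have adj := Adjunction.ofIsLeftAdjoint f
    refine ⟨adj.leftAdjoint_preservesColimits, fun b => ?_⟩
    refine ⟨Discrete PUnit.{v+1}, inferInstance, Functor.fromPUnit (f.rightAdjoint.obj b), ⟨?_⟩⟩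
    have e := (adj.representableBy b).toIso
    have t : IsTerminal (Discrete.mk PUnit.unit : Discrete PUnit.{v+1}) :=
      IsTerminal.ofUniqueHom (fun _ => eqToHom (by ext)) (fun _ _ => by subsingleton)
    exact e.symm ≪≫ (IsColimit.coconePointUniqueUpToIso
      (colimitOfDiagramTerminal t (Functor.fromPUnit (f.rightAdjoint.obj b) ⋙ yoneda))
      (colimit.isColimit _))
  · rintro ⟨hp, ha⟩
    apply Functor.isLeftAdjoint_of_rightAdjointObjIsDefined_eq_top
    ext b
    simp only [Pi.top_apply, Prop.top_eq_true, iff_true]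
    obtain ⟨J, _, G, ⟨i⟩⟩ := ha b
    exact ulmer_aux f b J G i
end

section
/- Let D be a class of small categories. Let A and B be locally small categories such that A has colimits of all diagrams indexed by categories belonging to D. Call a presheaf P : Aᵒᵖ ⥤ Type v D-generated if P belongs to the smallest class of presheaves on A that contains all representable presheaves, is closed under isomorphism, and is closed under colimits of diagrams indexed by categories belonging to D. Then a functor f : A ⥤ B has a right adjoint if and only if f preserves colimits of shape J for every J ∈ D and, for every object b of B, the presheaf B(f(−), b) : Aᵒᵖ ⥤ Type v (that is, f.op ⋙ yoneda.obj b) is D-generated. (Tholen's adjoint functor theorem, conical case.) -/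
open CategoryTheory CategoryTheory.Limits

universe v u₁ u₂

/-- The smallest class of presheaves on `A` containing the representables, closed under
isomorphism, and closed under colimits of diagrams indexed by categories belonging to `D`. -/
inductive DGenerated {A : Type u₁} [Category.{v} A] (D : Cat.{v, v} → Prop) :
    (Aᵒᵖ ⥤ Type v) → Prop
  | representable (a : A) : DGenerated D (yoneda.obj a)
  | of_iso {P Q : Aᵒᵖ ⥤ Type v} (e : P ≅ Q) : DGenerated D P → DGenerated D Q
  | colim {J : Cat.{v, v}} (hJ : D J) (G : J ⥤ (Aᵒᵖ ⥤ Type v))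
      (h : ∀ j : J, DGenerated D (G.obj j)) : DGenerated D (colimit G)

/-- Presheaves sending `D`-colimits to limits. -/
def DCont {A : Type u₁} [Category.{v} A] (D : Cat.{v, v} → Prop) :
    ObjectProperty (Aᵒᵖ ⥤ Type v) :=
  fun Z => ∀ J : Cat.{v, v}, D J → PreservesLimitsOfShape (J : Type v)ᵒᵖ Z

theorem exists_reflection_colim {A : Type u₁} [Category.{v} A] (D : Cat.{v, v} → Prop)
    (hA : ∀ J : Cat.{v, v}, D J → HasColimitsOfShape J A)
    {J : Cat.{v, v}} (hJ : D J) (G : J ⥤ (Aᵒᵖ ⥤ Type v))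
    (ih : ∀ j : J, ∃ (a : A) (η : G.obj j ⟶ yoneda.obj a), (DCont D).isLocal η) :
    ∃ (a : A) (η : colimit G ⟶ yoneda.obj a), (DCont D).isLocal η := by
  choose a η hη using ih
  have hy : ∀ x : A, DCont D (yoneda.obj x) := fun x J _ => inferInstance
  have hm : ∀ {i j : J} (g : i ⟶ j), ∃ m : a i ⟶ a j,
      η i ≫ yoneda.map m = G.map g ≫ η j := by
    intro i j g
    obtain ⟨m, h⟩ := (hη i _ (hy (a j))).2 (G.map g ≫ η j)
    exact ⟨yoneda.preimage m, by simpa using h⟩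
  have hu : ∀ {i : J} {x : A} (m n : a i ⟶ x),
      η i ≫ yoneda.map m = η i ≫ yoneda.map n → m = n := fun m n h =>
    yoneda.map_injective ((hη _ _ (hy _)).1 h)
  choose m hm using @hm
  let F : J ⥤ A :=
    { obj := a
      map := fun g => m g
      map_id := fun i => hu _ _ (by rw [hm]; simp)
      map_comp := fun g h => hu _ _ (by
        rw [hm, Functor.map_comp, Functor.map_comp, Category.assoc, ← hm, ← Category.assoc, ← hm,
          Category.assoc]) }
  have := hA J hJ
  let s : Cocone G :=
    { pt := yoneda.obj (colimit F)
      ι :=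
        { app := fun j => η j ≫ yoneda.map (colimit.ι F j)
          naturality := fun i j g => by
            have h : η i ≫ yoneda.map (F.map g) = G.map g ≫ η j := hm g
            rw [← Category.assoc, ← h, Category.assoc, ← Functor.map_comp, colimit.w]
            simp } }
  have hs : ∀ j, colimit.ι G j ≫ colimit.desc G s = η j ≫ yoneda.map (colimit.ι F j) :=
    fun j => colimit.ι_desc s j
  refine ⟨colimit F, colimit.desc G s, fun Z hZ => ?_⟩
  have := hZ J hJ
  have hl : IsLimit (Z.mapCone (colimit.cocone F).op) :=
    isLimitOfPreserves Z (colimit.isColimit F).op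
  rw [← Function.Bijective.of_comp_iff _ yonedaEquiv.symm.bijective]
  have hb := (Types.isLimit_iff_bijective_sectionOfCone _).1 ⟨hl⟩
  have key : ∀ (x : Z.obj (Opposite.op (colimit F))) (j : J),
      yoneda.map (colimit.ι F j) ≫ yonedaEquiv.symm x =
        yonedaEquiv.symm (Z.map (colimit.ι F j).op x) := by
    intro x j
    exact (yonedaEquiv_symm_map (colimit.ι F j).op x).symm
  constructor
  · intro x y h
    apply hb.1
    ext j
    have h1 := congrArg (fun t => colimit.ι G j.unop ≫ t) h
    dsimp only [Function.comp] at h1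
    rw [← Category.assoc, ← Category.assoc, hs, Category.assoc, Category.assoc, key, key] at h1
    exact (yonedaEquiv (F := Z)).symm.injective ((hη _ _ hZ).1 h1)
  · intro w
    choose wj hw using fun j : J => (hη j _ hZ).2 (colimit.ι G j ≫ w)
    dsimp only at hw
    obtain ⟨x, hx⟩ := hb.2 ⟨fun j => yonedaEquiv (F := Z) (wj j.unop), by
      intro i j g
      apply (yonedaEquiv (X := a j.unop) (F := Z)).symm.injective
      refine (yonedaEquiv_symm_map (F.map g.unop).op (yonedaEquiv (F := Z) (wj i.unop))).trans ?_
      apply (hη _ _ hZ).1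
      have h : η j.unop ≫ yoneda.map (F.map g.unop) = G.map g.unop ≫ η i.unop := hm g.unop
      simp only [Equiv.symm_apply_apply]
      rw [hw]
      refine (Category.assoc _ _ _).symm.trans ?_
      refine (congrArg (· ≫ wj i.unop) h).trans ?_
      rw [Category.assoc, hw, ← Category.assoc, colimit.w]⟩
    refine ⟨x, colimit.hom_ext fun j => ?_⟩
    dsimp only [Function.comp]
    rw [← Category.assoc, hs, Category.assoc, key, ← hw]
    congr 1
    apply yonedaEquiv.injective
    rw [Equiv.apply_symm_apply]
    exact congrFun (congrArg Subtype.val hx) (Opposite.op j)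

theorem exists_reflection {A : Type u₁} [Category.{v} A] (D : Cat.{v, v} → Prop)
    (hA : ∀ J : Cat.{v, v}, D J → HasColimitsOfShape J A)
    {P : Aᵒᵖ ⥤ Type v} (hP : DGenerated D P) :
    ∃ (a : A) (η : P ⟶ yoneda.obj a), (DCont D).isLocal η := by
  induction hP with
  | representable a => exact ⟨a, 𝟙 _, ObjectProperty.isLocal_of_isIso _ _⟩
  | of_iso e _ ih =>
    obtain ⟨a, η, h⟩ := ih
    exact ⟨a, e.inv ≫ η,
      (DCont D).isLocal.comp_mem _ _ (ObjectProperty.isLocal_of_isIso _ _) h⟩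
  | colim hJ G _ ih => exact exists_reflection_colim D hA hJ G ih

/-- Tholen's adjoint functor theorem (conical case): if `A` has colimits of all shapes in a
class `D` of small categories, then `f : A ⥤ B` has a right adjoint iff it preserves colimits
of every shape in `D` and each presheaf `B(f(−), b)` is `D`-generated. -/
theorem tholen_adjoint_functor_theorem {A : Type u₁} {B : Type u₂}
    [Category.{v} A] [Category.{v} B] (D : Cat.{v, v} → Prop)
    (hA : ∀ J : Cat.{v, v}, D J → HasColimitsOfShape J A) (f : A ⥤ B) :
    f.IsLeftAdjoint ↔
      ((∀ J : Cat.{v, v}, D J → PreservesColimitsOfShape J f) ∧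
        ∀ b : B, DGenerated D (f.op ⋙ yoneda.obj b)) := by
  constructor
  · intro hf
    have adj := Adjunction.ofIsLeftAdjoint f
    refine ⟨fun J _ => ?_, fun b => ?_⟩
    · have : PreservesColimitsOfSize.{v, v} f := adj.leftAdjoint_preservesColimits
      infer_instance
    · exact .of_iso (adj.representableBy b).toIso (.representable _)
  · rintro ⟨h1, h2⟩
    apply Functor.isLeftAdjoint_of_rightAdjointObjIsDefined_eq_top
    ext b
    simp only [Pi.top_apply, Prop.top_eq_true, iff_true]
    obtain ⟨a, η, h⟩ := exists_reflection D hA (h2 b)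
    have hb : DCont D (f.op ⋙ yoneda.obj b) := fun J hJ => by
      have := h1 J hJ
      have := preservesColimitsOfShape_of_equiv (opOpEquivalence J).symm f
      have : PreservesLimitsOfShape (J : Type v)ᵒᵖ f.op := preservesLimitsOfShape_op _ _
      infer_instance
    have : IsIso η := ((DCont D).isLocal_iff_isIso η hb (fun J _ => inferInstance)).1 h
    exact (Functor.representableByEquiv.symm (asIso η).symm).isRepresentable
end

section
/- Let A and B be locally small categories each having colimits of all small connected diagrams, and let f : A ⥤ B be a functor. Then the following are equivalent: (1) f is left multiadjoint, i.e. for every object b of B the presheaf B(f(−), b) : Aᵒᵖ ⥤ Type v (that is, f.op ⋙ yoneda.obj b) is isomorphic to a coproduct ∐_{i ∈ ι} yoneda.obj (a_i) of representable presheaves indexed by a small set ι; (2) f is small-admissible and f preserves colimits of all small connected diagrams. (Diers's multiadjoint functor theorem.) -/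
open CategoryTheory CategoryTheory.Limits

universe v u₁ u₂

/-- A functor `f : A ⥤ B` is left multiadjoint if, for every `b : B`, the presheaf
`B(f(−), b)` is isomorphic to a small coproduct of representables. -/
def LeftMultiadjoint {A : Type u₁} {B : Type u₂} [Category.{v} A] [Category.{v} B]
    (f : A ⥤ B) : Prop :=
  ∀ b : B, ∃ (ι : Type v) (a : ι → A),
    Nonempty ((f.op ⋙ yoneda.obj b) ≅ ∐ fun i : ι => yoneda.obj (a i))

namespace DiersAux

variable {A : Type u₁} {B : Type u₂} [Category.{v} A] [Category.{v} B]

/-- Restriction on concrete sums of representables. -/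
def res {ι : Type v} {a : ι → A} {X Y : A} (g : X ⟶ Y) (q : Σ i, (Y ⟶ a i)) :
    Σ i, (X ⟶ a i) := ⟨q.1, g ≫ q.2⟩

/-- The concrete coproduct of representables. -/
def sumPre {ι : Type v} (a : ι → A) : Aᵒᵖ ⥤ Type v where
  obj X := Σ i, (X.unop ⟶ a i)
  map g := TypeCat.ofHom (res g.unop)
  map_id X := by ext ⟨i, x⟩ <;> simp [res]
  map_comp g h := by ext ⟨i, x⟩ <;> simp [res]

/-- Injections. -/
def inj {ι : Type v} (a : ι → A) (i : ι) : yoneda.obj (a i) ⟶ sumPre a where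
  app X := TypeCat.ofHom (fun (x : X.unop ⟶ a i) => (⟨i, x⟩ : Σ i, (X.unop ⟶ a i)))
  naturality X Y g := by
    ext x
    rfl

/-- Descent. -/
def sumDesc {ι : Type v} (a : ι → A) (P : Aᵒᵖ ⥤ Type v) (p : ∀ i, yoneda.obj (a i) ⟶ P) :
    sumPre a ⟶ P where
  app X := TypeCat.ofHom (fun (x : Σ i, (X.unop ⟶ a i)) => (p x.1).app X x.2)
  naturality X Y g := by
    ext ⟨i, x⟩
    exact (NatTrans.naturality_apply (p i) g x)

/-- The concrete sum is the coproduct. -/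
noncomputable def sumIso {ι : Type v} (a : ι → A) :
    (∐ fun i : ι => yoneda.obj (a i)) ≅ sumPre a where
  hom := Sigma.desc (inj a)
  inv := sumDesc a _ (Sigma.ι (fun i : ι => yoneda.obj (a i)))
  hom_inv_id := by
    apply Sigma.hom_ext
    intro i
    rw [Sigma.ι_desc_assoc, Category.comp_id]
    rfl
  inv_hom_id := by
    ext X z
    obtain ⟨i, x⟩ := (show Σ i, (X.unop ⟶ a i) from z)
    have := Sigma.ι_desc (inj a) i
    exact congrArg (fun t : yoneda.obj (a i) ⟶ sumPre a => t.app X x) this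

lemma exists_glue {ι : Type v} (a : ι → A) {J : Type v} [SmallCategory J] [IsConnected J]
    {F : J ⥤ A} {t : Cocone F} (ht : IsColimit t) (q : ∀ j, Σ i, (F.obj j ⟶ a i))
    (hq : ∀ {j k} (g : j ⟶ k), res (F.map g) (q k) = q j) :
    ∃ r : Σ i, (t.pt ⟶ a i), ∀ j, res (t.ι.app j) r = q j := by
  obtain ⟨j₀⟩ := (inferInstance : Nonempty J)
  have h1 : ∀ j, (q j).1 = (q j₀).1 := fun j =>
    constant_of_preserves_morphisms (fun j => (q j).1)
      (fun j k g => (congrArg Sigma.fst (hq g)).symm) j j₀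
  generalize (q j₀).1 = i at h1
  have h2 : ∀ j, ∃ x : F.obj j ⟶ a i, q j = ⟨i, x⟩ := by
    intro j
    have := h1 j
    generalize q j = z at this
    obtain ⟨_, z⟩ := z
    obtain rfl := this
    exact ⟨z, rfl⟩
  choose x hx using h2
  let s : Cocone F := { pt := a i, ι := { app := x, naturality := fun j k g => by
                                               have := hq g
                                               rw [hx, hx] at this
                                               simpa [res] using this } }
  refine ⟨⟨i, ht.desc s⟩, fun j => ?_⟩
  rw [hx, res, ht.fac]

lemma glue_unique {ι : Type v} (a : ι → A) {J : Type v} [SmallCategory J] [IsConnected J]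
    {F : J ⥤ A} {t : Cocone F} (ht : IsColimit t) (q r : Σ i, (t.pt ⟶ a i))
    (h : ∀ j, res (t.ι.app j) q = res (t.ι.app j) r) : q = r := by
  obtain ⟨j₀⟩ := (inferInstance : Nonempty J)
  obtain ⟨i, q⟩ := q
  obtain ⟨k, r⟩ := r
  obtain rfl : i = k := congrArg Sigma.fst (h j₀)
  congr 1
  apply ht.hom_ext
  intro j
  simpa [res] using h j

lemma preserves {f : A ⥤ B} (hf : LeftMultiadjoint f) (J : Type v) [SmallCategory J]
    [IsConnected J] : PreservesColimitsOfShape J f := by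
  have key : ∀ b : B, ∃ (ι : Type v) (a : ι → A) (e : ∀ X, (f.obj X ⟶ b) ≃ Σ i, (X ⟶ a i)),
      ∀ X Y (g : X ⟶ Y) (y : f.obj Y ⟶ b), e X (f.map g ≫ y) = res g (e Y y) := by
    intro b
    obtain ⟨ι, a, ⟨α⟩⟩ := hf b
    let β := α ≪≫ sumIso a
    refine ⟨ι, a, fun X => (β.app (.op X)).toEquiv, fun X Y g y => ?_⟩
    exact NatTrans.naturality_apply β.hom g.op y
  choose ι a e he using key
  refine ⟨fun {F} => ⟨fun {t} ht => ?_⟩⟩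
  have ex : ∀ s : Cocone (F ⋙ f), ∃ m : f.obj t.pt ⟶ s.pt,
      ∀ j, f.map (t.ι.app j) ≫ m = s.ι.app j := by
    intro s
    obtain ⟨r, hr⟩ := exists_glue (a s.pt) ht (fun j => e s.pt _ (s.ι.app j)) (by
      intro j k g
      rw [← he]
      congr 1
      exact s.w g)
    refine ⟨(e s.pt _).symm r, fun j => ?_⟩
    apply (e s.pt _).injective
    refine (he s.pt _ _ (t.ι.app j) _).trans ?_
    refine (congrArg _ (Equiv.apply_symm_apply _ _)).trans (hr j)
  choose m hm using ex
  refine ⟨{ desc := m, fac := hm, uniq := fun s m' hm' => ?_ }⟩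
  apply (e s.pt _).injective
  apply glue_unique _ ht
  intro j
  refine (he s.pt _ _ (t.ι.app j) _).symm.trans (Eq.trans ?_ (he s.pt _ _ (t.ι.app j) _))
  exact congrArg _ ((hm' j).trans (hm s j).symm)

lemma admissible {f : A ⥤ B} (hf : LeftMultiadjoint f) : SmallAdmissible f := by
  intro b
  obtain ⟨ι, a, ⟨α⟩⟩ := hf b
  refine ⟨Discrete ι, inferInstance, Discrete.functor a, ⟨α ≪≫ ?_⟩⟩
  exact HasColimit.isoOfNatIso (Discrete.natIso (fun i => Iso.refl _))

lemma multi (hA : ∀ (J : Type v) [SmallCategory J], IsConnected J → HasColimitsOfShape J A)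
    {f : A ⥤ B} (hf : SmallAdmissible f)
    (hp : ∀ (J : Type v) [SmallCategory J], IsConnected J → PreservesColimitsOfShape J f) :
    LeftMultiadjoint f := by
  intro b
  obtain ⟨J, _, G, ⟨α⟩⟩ := hf b
  have hA' : ∀ c : ConnectedComponents J, HasColimitsOfShape c.Component A :=
    fun c => hA _ inferInstance
  have hp' : ∀ c : ConnectedComponents J, PreservesColimitsOfShape c.Component f :=
    fun c => hp _ inferInstance
  let a : ConnectedComponents J → A := fun c => colimit (c.ι ⋙ G)
  -- the elements p_j
  let π : ∀ j, yoneda.obj (G.obj j) ⟶ f.op ⋙ yoneda.obj b :=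
    fun j => colimit.ι (G ⋙ yoneda) j ≫ α.inv
  have hπ : ∀ {j k} (g : j ⟶ k), yoneda.map (G.map g) ≫ π k = π j := fun g => by
    simp only [π, ← Category.assoc]
    congr 1
    exact colimit.w (G ⋙ yoneda) g
  let p : ∀ j, f.obj (G.obj j) ⟶ b := fun j => yonedaEquiv (π j)
  have hπp : ∀ j X (x : X ⟶ G.obj j), (π j).app (.op X) x = f.map x ≫ p j := by
    intro j X x
    have := NatTrans.naturality_apply (π j) x.op (𝟙 (G.obj j))
    refine Eq.trans ?_ this
    exact congrArg _ (Category.comp_id x).symm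
  have hpw : ∀ {j k} (g : j ⟶ k), f.map (G.map g) ≫ p k = p j := fun {j k} g => by
    rw [← hπp]
    have := congrArg (fun t : yoneda.obj (G.obj j) ⟶ _ => t.app (.op (G.obj j)) (𝟙 _)) (hπ g)
    refine Eq.trans ?_ this
    exact congrArg ((π k).app _) (Category.id_comp (G.map g)).symm
  have cc : ∀ {j k : J} (g : j ⟶ k), CategoryTheory.ConnectedComponents.mk j = CategoryTheory.ConnectedComponents.mk k :=
    fun g => Quotient.sound (Zigzag.of_hom g)
  let inc : ∀ j, Σ c, (G.obj j ⟶ a c) := fun j =>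
    ⟨CategoryTheory.ConnectedComponents.mk j, colimit.ι ((CategoryTheory.ConnectedComponents.mk j).ι ⋙ G) ⟨j, rfl⟩⟩
  have hinc' : ∀ (c : ConnectedComponents J) (j : c.Component),
      inc j.obj = ⟨c, colimit.ι (c.ι ⋙ G) j⟩ := by
    rintro c ⟨j, rfl⟩
    rfl
  have hinc : ∀ {j k} (g : j ⟶ k), res (G.map g) (inc k) = inc j := by
    intro j k g
    rw [hinc' (CategoryTheory.ConnectedComponents.mk k) ⟨j, cc g⟩]
    simp only [res, inc]
    congr 1
    exact colimit.w ((CategoryTheory.ConnectedComponents.mk k).ι ⋙ G)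
      (j' := ⟨j, cc g⟩) (j := ⟨k, rfl⟩) ⟨g⟩
  let r : (f.op ⋙ yoneda.obj b) ⟶ sumPre a := α.hom ≫ colimit.desc (G ⋙ yoneda)
    { pt := sumPre a
      ι := { app := fun j => yonedaEquiv.symm (inc j)
             naturality := fun j k g => by
              ext X x
              have := hinc g
              change (⟨_, (x ≫ G.map g) ≫ (inc k).2⟩ : Σ c, (X.unop ⟶ a c)) = res x (inc j)
              rw [← this]
              simp [res] } }
  have hr : ∀ j, r.app (.op (G.obj j)) (p j) = inc j := by
    intro j
    have h1 : π j ≫ r = yonedaEquiv.symm (inc j) := by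
      simp [π, r]
    have h2 := congrArg (fun t : yoneda.obj (G.obj j) ⟶ _ => t.app (.op (G.obj j)) (𝟙 _)) h1
    refine h2.trans ?_
    change res (𝟙 _) (inc j) = inc j
    simp [res]
  have hs : ∀ c, ∃ s : f.obj (a c) ⟶ b, ∀ j, f.map (colimit.ι (c.ι ⋙ G) j) ≫ s = p j.obj := by
    intro c
    let t : Cocone ((c.ι ⋙ G) ⋙ f) := { pt := b, ι := {
      app := fun j => p j.obj
      naturality := fun j k g => (hpw g.hom).trans (Category.comp_id _).symm } }
    exact ⟨(isColimitOfPreserves f (colimit.isColimit (c.ι ⋙ G))).desc t,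
      fun j => (isColimitOfPreserves f (colimit.isColimit (c.ι ⋙ G))).fac t j⟩
  choose s hs using hs
  let S : sumPre a ⟶ f.op ⋙ yoneda.obj b := sumDesc a _ (fun c => yonedaEquiv.symm (s c))
  have hS : ∀ X c (x : X ⟶ a c), S.app (.op X) (⟨c, x⟩ : Σ c, (X ⟶ a c)) = f.map x ≫ s c := by
    intro X c x
    rfl
  refine ⟨ConnectedComponents J, a, ⟨?_ ≪≫ (sumIso a).symm⟩⟩
  refine { hom := r, inv := S, hom_inv_id := ?_, inv_hom_id := ?_ }
  · rw [← cancel_epi α.inv]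
    apply colimit.hom_ext
    intro j
    apply yonedaEquiv.injective
    have h4 : S.app (.op (G.obj j)) (inc j) = p j :=
      hs (CategoryTheory.ConnectedComponents.mk j) ⟨j, rfl⟩
    have h5 := (congrArg (S.app (.op (G.obj j))) (hr j)).trans h4
    refine Eq.trans ?_ (h5.trans ?_)
    · rfl
    · simp [p, π]
  · ext ⟨X⟩ z
    obtain ⟨c, x⟩ := (show Σ i, (X ⟶ a i) from z)
    have h1 : r.app (.op (a c)) (s c) = (⟨c, 𝟙 (a c)⟩ : Σ i, (a c ⟶ a i)) := by
      apply glue_unique a (colimit.isColimit (c.ι ⋙ G))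
      intro j
      have h2 := NatTrans.naturality_apply r (colimit.ι (c.ι ⋙ G) j).op (s c)
      refine h2.symm.trans ?_
      refine (congrArg (r.app (.op (G.obj j.obj))) (hs c j)).trans ?_
      rw [hr, hinc']
      exact congrArg (Sigma.mk c) (Category.comp_id (colimit.ι (c.ι ⋙ G) j)).symm
    have h3 := NatTrans.naturality_apply r x.op (s c)
    refine h3.trans ?_
    refine (congrArg ((sumPre a).map x.op) h1).trans ?_
    change (⟨c, x ≫ 𝟙 _⟩ : Σ i, (X ⟶ a i)) = ⟨c, x⟩
    rw [Category.comp_id]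

end DiersAux

/-- Diers's multiadjoint functor theorem: for `f : A ⥤ B` between locally small categories
with colimits of all small connected diagrams, `f` is left multiadjoint iff `f` is
small-admissible and preserves colimits of all small connected diagrams. -/
theorem diers_multiadjoint_functor_theorem {A : Type u₁} {B : Type u₂}
    [Category.{v} A] [Category.{v} B]
    (hA : ∀ (J : Type v) [SmallCategory J], IsConnected J → HasColimitsOfShape J A)
    (hB : ∀ (J : Type v) [SmallCategory J], IsConnected J → HasColimitsOfShape J B)
    (f : A ⥤ B) :
    LeftMultiadjoint f ↔
      (SmallAdmissible f ∧
        ∀ (J : Type v) [SmallCategory J], IsConnected J → PreservesColimitsOfShape J f) := by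
  constructor
  · intro h
    exact ⟨DiersAux.admissible h, fun J _ _ => DiersAux.preserves h J⟩
  · rintro ⟨h, hp⟩
    exact DiersAux.multi hA h hp
end

section
/- Let A and B be locally small categories each having all finite colimits, and let f : A ⥤ B be a functor. Then the following are equivalent: (1) f is left pluriadjoint, i.e. for every object b of B the presheaf B(f(−), b) : Aᵒᵖ ⥤ Type v (that is, f.op ⋙ yoneda.obj b) is isomorphic to the colimit of a diagram G ⋙ yoneda for some small filtered category J and functor G : J ⥤ A; (2) f is small-admissible and f preserves all finite colimits. (The pluriadjoint functor theorem of Solian and Viswanathan.) -/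
open CategoryTheory CategoryTheory.Limits

universe v u₁ u₂

/-- A functor `f : A ⥤ B` is left pluriadjoint if, for every `b : B`, the presheaf
`B(f(−), b)` is isomorphic to a small filtered colimit of representables. -/
def LeftPluriadjoint {A : Type u₁} {B : Type u₂} [Category.{v} A] [Category.{v} B]
    (f : A ⥤ B) : Prop :=
  ∀ b : B, ∃ (J : Type v) (_ : SmallCategory J) (_ : IsFiltered J) (G : J ⥤ A),
    Nonempty ((f.op ⋙ yoneda.obj b) ≅ colimit (G ⋙ yoneda))

/-- The comparison functor `(f ↓ b) ⥤ (yoneda ↓ B(f(−), b))`. -/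
def pluriComparison {A : Type u₁} {B : Type u₂} [Category.{v} A] [Category.{v} B]
    (f : A ⥤ B) (b : B) :
    CostructuredArrow f b ⥤ CostructuredArrow yoneda (f.op ⋙ yoneda.obj b) where
  obj X := CostructuredArrow.mk (Y := X.left)
    ((yonedaEquiv (F := f.op ⋙ yoneda.obj b)).symm X.hom)
  map {X Y} g := CostructuredArrow.homMk g.left (by
    have := CostructuredArrow.w g
    refine (yonedaEquiv_symm_naturality_left g.left (f.op ⋙ yoneda.obj b) Y.hom).trans ?_
    exact congrArg (yonedaEquiv (F := f.op ⋙ yoneda.obj b)).symm this)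

instance {A : Type u₁} {B : Type u₂} [Category.{v} A] [Category.{v} B]
    (f : A ⥤ B) (b : B) : (pluriComparison f b).IsEquivalence where
  faithful := ⟨fun {X Y} g h e => by
    ext
    exact congrArg (fun k => k.left) e⟩
  full := ⟨fun {X Y} g => by
    refine ⟨CostructuredArrow.homMk g.left ?_, ?_⟩
    · have h1 := CostructuredArrow.w g
      have h2 := yonedaEquiv_symm_naturality_left g.left (f.op ⋙ yoneda.obj b) Y.hom
      exact (yonedaEquiv (F := f.op ⋙ yoneda.obj b)).symm.injective (h2.symm.trans h1)
    · ext
      rfl⟩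
  essSurj := ⟨fun Y => ⟨CostructuredArrow.mk (Y := Y.left)
      (show f.obj Y.left ⟶ b from yonedaEquiv (F := f.op ⋙ yoneda.obj b) Y.hom),
    ⟨CostructuredArrow.isoMk (Iso.refl _) (by
      apply yonedaEquiv.injective
      simp [pluriComparison])⟩⟩⟩

/-- `B(f(−), b)` is an ind-object iff it is a small colimit of representables and `f ↓ b` is
filtered. -/
theorem leftPluriadjoint_iff_coflat {A : Type u₁} {B : Type u₂} [Category.{v} A] [Category.{v} B]
    (f : A ⥤ B) : LeftPluriadjoint f ↔ (SmallAdmissible f ∧ RepresentablyCoflat f) := by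
  constructor
  · intro h
    refine ⟨fun b => ?_, ⟨fun b => ?_⟩⟩
    · obtain ⟨J, hJ, _, G, e⟩ := h b
      exact ⟨J, hJ, G, e⟩
    · obtain ⟨J, hJ, _, G, ⟨e⟩⟩ := h b
      have h1 : IsIndObject (f.op ⋙ yoneda.obj b) :=
        IsIndObject.map e.inv (IsIndObject.mk
          (IndObjectPresentation.ofCocone _ (colimit.isColimit (G ⋙ yoneda))))
      have := h1.isFiltered
      exact IsFiltered.of_equivalence (pluriComparison f b).asEquivalence.symm
  · rintro ⟨h, hc⟩ b
    obtain ⟨J, hJ, G, ⟨e⟩⟩ := h b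
    have h1 := hc.filtered b
    have h2 : IsFiltered (CostructuredArrow yoneda (f.op ⋙ yoneda.obj b)) :=
      IsFiltered.of_equivalence (pluriComparison f b).asEquivalence
    have h3 := Presheaf.final_toCostructuredArrow_comp_pre _ (colimit.isColimit (G ⋙ yoneda))
    have h4 : FinallySmall.{v} (CostructuredArrow yoneda (colimit (G ⋙ yoneda))) :=
      FinallySmall.mk' ((colimit.cocone (G ⋙ yoneda)).toCostructuredArrow ⋙
        CostructuredArrow.pre G yoneda (colimit.cocone (G ⋙ yoneda)).pt)
    have h5 : FinallySmall.{v} (CostructuredArrow yoneda (f.op ⋙ yoneda.obj b)) :=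
      finallySmall_of_final_of_finallySmall (CostructuredArrow.mapIso e.symm).functor
    obtain ⟨⟨P⟩⟩ := isIndObject_of_isFiltered_of_finallySmall (f.op ⋙ yoneda.obj b)
    exact ⟨P.I, inferInstance, inferInstance, P.F,
      ⟨P.coconeIsColimit.coconePointUniqueUpToIso (colimit.isColimit _)⟩⟩

/-- The pluriadjoint functor theorem of Solian and Viswanathan: for `f : A ⥤ B` between
locally small categories with all finite colimits, `f` is left pluriadjoint iff `f` is
small-admissible and preserves all finite colimits. -/
theorem solian_viswanathan_pluriadjoint_functor_theorem {A : Type u₁} {B : Type u₂}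
    [Category.{v} A] [Category.{v} B] [HasFiniteColimits A] [HasFiniteColimits B]
    (f : A ⥤ B) :
    LeftPluriadjoint f ↔ (SmallAdmissible f ∧ PreservesFiniteColimits f) := by
  rw [leftPluriadjoint_iff_coflat, preservesFiniteColimits_iff_coflat]
end

section
/- Let A and B be locally small categories each having all small colimits, and let f : A ⥤ B be a functor. Then the following are equivalent: (1) f is semiadjoint, i.e. for every object b of B the presheaf B(f(−), b) : Aᵒᵖ ⥤ Type v (that is, f.op ⋙ yoneda.obj b) is a retract of a representable presheaf, meaning there exist an object a of A and morphisms s : B(f(−), b) ⟶ yoneda.obj a and r : yoneda.obj a ⟶ B(f(−), b) with r ∘ s = id; (2) f is small-admissible and f preserves all small colimits. -/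
open CategoryTheory CategoryTheory.Limits

universe v u₁ u₂

/-- A functor `f : A ⥤ B` is semiadjoint if, for every `b : B`, the presheaf `B(f(−), b)` is
a retract of a representable presheaf. -/
def Semiadjoint {A : Type u₁} {B : Type u₂} [Category.{v} A] [Category.{v} B]
    (f : A ⥤ B) : Prop :=
  ∀ b : B, ∃ (a : A) (s : (f.op ⋙ yoneda.obj b) ⟶ yoneda.obj a)
    (r : yoneda.obj a ⟶ (f.op ⋙ yoneda.obj b)), s ≫ r = 𝟙 (f.op ⋙ yoneda.obj b)

theorem semi_repr {A : Type u₁} {B : Type u₂} [Category.{v} A] [Category.{v} B]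
    [HasColimitsOfSize.{v, v} A] (f : A ⥤ B) (h : Semiadjoint f) (b : B) :
    ∃ c : A, Nonempty (yoneda.obj c ≅ (f.op ⋙ yoneda.obj b)) := by
  obtain ⟨a, s, r, hsr⟩ := h b
  obtain ⟨e, he⟩ := yoneda.map_surjective (r ≫ s)
  have hee : e ≫ e = e := by
    apply yoneda.map_injective
    rw [Functor.map_comp, he, Category.assoc, reassoc_of% hsr]
  have : HasColimitsOfSize.{0, 0} A := hasColimitsOfSizeShrink.{0, 0, v, v} A
  let p := coequalizer.π e (𝟙 a)
  let i : coequalizer e (𝟙 a) ⟶ a := coequalizer.desc e (by simp [hee])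
  have hpi : p ≫ i = e := coequalizer.π_desc _ _
  have hep : e ≫ p = p := by
    have := coequalizer.condition e (𝟙 a)
    simpa using this
  have hip : i ≫ p = 𝟙 _ := by
    apply coequalizer.hom_ext
    change p ≫ i ≫ p = p ≫ 𝟙 _
    rw [reassoc_of% hpi, hep, Category.comp_id]
  refine ⟨coequalizer e (𝟙 a), ⟨⟨yoneda.map i ≫ r, s ≫ yoneda.map p, ?_, ?_⟩⟩⟩
  · have : yoneda.map i ≫ (r ≫ s) ≫ yoneda.map p = 𝟙 _ := by
      rw [← he, ← Functor.map_comp, ← Functor.map_comp, hep, hip, CategoryTheory.Functor.map_id]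
    simpa only [Category.assoc] using this
  · have : s ≫ (yoneda.map p ≫ yoneda.map i) ≫ r = 𝟙 _ := by
      rw [← Functor.map_comp, hpi, he, Category.assoc, hsr, Category.comp_id, hsr]
    simpa only [Category.assoc] using this

theorem semi_of {A : Type u₁} {B : Type u₂} [Category.{v} A] [Category.{v} B]
    [HasColimitsOfSize.{v, v} A] (f : A ⥤ B) (h : SmallAdmissible f)
    [PreservesColimitsOfSize.{v, v} f] : Semiadjoint f := by
  intro b
  obtain ⟨J, _, G, ⟨φ⟩⟩ := h b
  let c : Cocone (G ⋙ f) :=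
    { pt := b
      ι := { app := fun j => yonedaEquiv (F := f.op ⋙ yoneda.obj b)
                (colimit.ι (G ⋙ yoneda) j ≫ φ.inv)
             naturality := fun j k g => by
              have h1 := colimit.w (G ⋙ yoneda) g
              have h2 := yonedaEquiv_naturality (F := f.op ⋙ yoneda.obj b)
                (colimit.ι (G ⋙ yoneda) k ≫ φ.inv) (G.map g)
              have h3 : yoneda.map (G.map g) ≫ colimit.ι (G ⋙ yoneda) k ≫ φ.inv
                 = colimit.ι (G ⋙ yoneda) j ≫ φ.inv := by
                rw [← h1]; simp
              rw [h3] at h2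
              simpa using h2 } }
  let hc := isColimitOfPreserves f (colimit.isColimit G)
  let x : f.obj (colimit G) ⟶ b := hc.desc c
  refine ⟨colimit G, φ.hom ≫ colimit.desc (G ⋙ yoneda) (yoneda.mapCocone (colimit.cocone G)),
    yonedaEquiv.symm x, ?_⟩
  rw [← cancel_epi φ.inv]
  apply colimit.hom_ext
  intro j
  rw [Category.assoc, Iso.inv_hom_id_assoc, colimit.ι_desc_assoc, Category.comp_id]
  apply yonedaEquiv.injective
  have h1 : f.map (colimit.ι G j) ≫ x = c.ι.app j := hc.fac c j
  have h2 := yonedaEquiv_naturality (F := f.op ⋙ yoneda.obj b)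
                (yonedaEquiv.symm x) (colimit.ι G j)
  rw [Equiv.apply_symm_apply] at h2
  exact h2.symm.trans h1

/-- The semiadjoint functor theorem: for `f : A ⥤ B` between locally small categories with all
small colimits, `f` is semiadjoint iff `f` is small-admissible and preserves all small
colimits. -/
theorem semiadjoint_functor_theorem {A : Type u₁} {B : Type u₂}
    [Category.{v} A] [Category.{v} B]
    [HasColimitsOfSize.{v, v} A] [HasColimitsOfSize.{v, v} B] (f : A ⥤ B) :
    Semiadjoint f ↔ (SmallAdmissible f ∧ PreservesColimitsOfSize.{v, v} f) := by
  constructor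
  · intro h
    choose c hc using semi_repr f h
    constructor
    · intro b
      obtain ⟨i⟩ := hc b
      refine ⟨Discrete PUnit.{v + 1}, inferInstance, (Functor.const _).obj (c b),
        ⟨i.symm ≪≫ ?_⟩⟩
      exact (isColimitConstCocone (Discrete PUnit.{v + 1})
        (yoneda.obj (c b))).coconePointUniqueUpToIso (colimit.isColimit _) ≪≫
          HasColimit.isoOfNatIso (Functor.constComp (Discrete PUnit.{v + 1}) (c b) yoneda).symm
    · let adj := Adjunction.adjunctionOfEquivRight (F := f) (G_obj := c)
        (fun X Y => ((hc Y).some.app (Opposite.op X)).toEquiv.symm) (by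
          intro X' X Y g k
          exact congr($((hc Y).some.inv.naturality g.op) k))
      exact adj.leftAdjoint_preservesColimits
  · rintro ⟨h, _⟩
    exact semi_of f h
end

section
/- Let A be a locally small category having colimits of all small connected diagrams, let B be a locally small category, and let f : A ⥤ B be a functor such that for every object b of B the presheaf B(f(−), b) : Aᵒᵖ ⥤ Type v (that is, f.op ⋙ yoneda.obj b) is isomorphic to a coproduct ∐_{i ∈ ι} yoneda.obj (a_i) of representable presheaves indexed by a small set ι. Then f preserves colimits of all small connected diagrams. -/
open CategoryTheory CategoryTheory.Limits

universe v u₁ u₂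

/-- The explicit coproduct of representables. -/
def sigmaPresheaf {A : Type u₁} [Category.{v} A] {ι : Type v} (a : ι → A) :
    Aᵒᵖ ⥤ Type v where
  obj x := Σ i, (x.unop ⟶ a i)
  map g := TypeCat.ofHom fun p => ⟨p.1, g.unop ≫ p.2⟩
  map_id x := by
    ext p
    · rfl
    · exact heq_of_eq (Category.id_comp p.2)
  map_comp g h := by
    ext p
    · rfl
    · exact heq_of_eq (Category.assoc h.unop g.unop p.2)

/-- The inclusion of a summand. -/
def sigmaPresheafIncl {A : Type u₁} [Category.{v} A] {ι : Type v} (a : ι → A) (i : ι) :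
    yoneda.obj (a i) ⟶ sigmaPresheaf a where
  app x := TypeCat.ofHom fun h => ⟨i, h⟩
  naturality x y g := by ext p; rfl

lemma exists_universal {A : Type u₁} {B : Type u₂}
    [Category.{v} A] [Category.{v} B] (f : A ⥤ B) (b : B) (ι : Type v) (a : ι → A)
    (e : (f.op ⋙ yoneda.obj b) ≅ ∐ fun i : ι => yoneda.obj (a i)) :
    ∃ u : ∀ i, f.obj (a i) ⟶ b,
      (∀ (x : A) (g : f.obj x ⟶ b), ∃ (i : ι) (h : x ⟶ a i), f.map h ≫ u i = g) ∧
      (∀ (x : A) (i j : ι) (h : x ⟶ a i) (h' : x ⟶ a j), f.map h ≫ u i = f.map h' ≫ u j →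
        (⟨i, h⟩ : Σ i, (x ⟶ a i)) = ⟨j, h'⟩) := by
  let Y : ι → Aᵒᵖ ⥤ Type v := fun i => yoneda.obj (a i)
  let w : ∀ i, Y i ⟶ f.op ⋙ yoneda.obj b := fun i => Sigma.ι Y i ≫ e.inv
  have key : ∀ (x : A) (i : ι) (h : x ⟶ a i),
      f.map h ≫ ((w i).app (Opposite.op (a i)) (𝟙 (a i)) : f.obj (a i) ⟶ b) =
        (w i).app (Opposite.op x) h := by
    intro x i h
    have := ConcreteCategory.congr_hom ((w i).naturality h.op) (𝟙 (a i))
    refine Eq.trans this.symm ?_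
    change (w i).app (Opposite.op x) (h ≫ 𝟙 (a i)) = _
    rw [Category.comp_id]
  refine ⟨fun i => (w i).app (Opposite.op (a i)) (𝟙 (a i)), ?_, ?_⟩
  · intro x g
    have hc := isColimitOfPreserves ((evaluation Aᵒᵖ (Type v)).obj (Opposite.op x))
      (colimit.isColimit (Discrete.functor Y))
    obtain ⟨⟨i⟩, y, hy⟩ := Types.jointly_surjective_of_isColimit hc
      (e.hom.app (Opposite.op x) g)
    refine ⟨i, y, (key x i y).trans ?_⟩
    have h1 : (w i).app (Opposite.op x) y =
      e.inv.app (Opposite.op x) ((Sigma.ι Y i).app (Opposite.op x) y) := rfl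
    have h2 : (Sigma.ι Y i).app (Opposite.op x) y = e.hom.app (Opposite.op x) g := hy
    rw [h1, h2]
    exact ConcreteCategory.congr_hom (e.hom_inv_id_app (Opposite.op x)) g
  · intro x i j h h' H
    have H' := (key x i h).symm.trans (H.trans (key x j h'))
    let d : (f.op ⋙ yoneda.obj b) ⟶ sigmaPresheaf a :=
      e.hom ≫ Sigma.desc (f := Y) (sigmaPresheafIncl a)
    have hd : ∀ i, w i ≫ d = sigmaPresheafIncl a i := by
      intro i
      simp [w, d]
    have hd' : ∀ i (h : x ⟶ a i), d.app (Opposite.op x) ((w i).app (Opposite.op x) h) =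
        (⟨i, h⟩ : Σ i, (x ⟶ a i)) := by
      intro i h
      exact ConcreteCategory.congr_hom (NatTrans.congr_app (hd i) (Opposite.op x)) h
    exact (hd' i h).symm.trans ((congrArg (d.app (Opposite.op x)) H').trans (hd' j h'))

/-- A left multiadjoint functor (each presheaf `B(f(−), b)` is a small coproduct of
representables) from a category with colimits of all small connected diagrams preserves
colimits of all small connected diagrams. -/
theorem multiadjoint_preserves_connected_colimits {A : Type u₁} {B : Type u₂}
    [Category.{v} A] [Category.{v} B]
    (hA : ∀ (J : Type v) [SmallCategory J], IsConnected J → HasColimitsOfShape J A)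
    (f : A ⥤ B)
    (hf : ∀ b : B, ∃ (ι : Type v) (a : ι → A),
      Nonempty ((f.op ⋙ yoneda.obj b) ≅ ∐ fun i : ι => yoneda.obj (a i))) :
    ∀ (J : Type v) [SmallCategory J], IsConnected J → PreservesColimitsOfShape J f := by
  intro J _ hJ
  refine ⟨fun {K} => ⟨fun {c} hc => ?_⟩⟩
  have ex : ∀ s : Cocone (K ⋙ f), ∃ m : f.obj c.pt ⟶ s.pt,
      ∀ j, f.map (c.ι.app j) ≫ m = s.ι.app j := by
    intro s
    obtain ⟨ι, a, ⟨e⟩⟩ := hf s.pt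
    obtain ⟨u, hu, hinj⟩ := exists_universal f s.pt ι a e
    choose i h hh using fun j => hu (K.obj j) (s.ι.app j)
    have hs : ∀ {j j' : J} (φ : j ⟶ j'),
        (⟨i j, h j⟩ : Σ i, (K.obj j ⟶ a i)) = ⟨i j', K.map φ ≫ h j'⟩ := by
      intro j j' φ
      apply hinj
      rw [f.map_comp, Category.assoc, hh, hh]
      exact (s.w φ).symm
    obtain ⟨i₀, hi₀⟩ := constant_of_preserves_morphisms' i
      (fun j j' φ => congrArg Sigma.fst (hs φ))
    obtain rfl : i = fun _ => i₀ := funext hi₀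
    let t : Cocone K :=
      { pt := a i₀
        ι := { app := h
               naturality := by
                intro j j' φ
                have := hs φ
                simp only [Sigma.mk.injEq, heq_eq_eq, true_and] at this
                simp [← this] } }
    refine ⟨f.map (hc.desc t) ≫ u i₀, fun j => ?_⟩
    rw [← Category.assoc, ← f.map_comp, hc.fac]
    exact hh j
  have un : ∀ (b : B) (m m' : f.obj c.pt ⟶ b),
      (∀ j, f.map (c.ι.app j) ≫ m = f.map (c.ι.app j) ≫ m') → m = m' := by
    intro b m m' H
    obtain ⟨ι, a, ⟨e⟩⟩ := hf b
    obtain ⟨u, hu, hinj⟩ := exists_universal f b ι a e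
    obtain ⟨i, h, rfl⟩ := hu _ m
    obtain ⟨i', h', rfl⟩ := hu _ m'
    have H' : ∀ j, (⟨i, c.ι.app j ≫ h⟩ : Σ i, (K.obj j ⟶ a i)) = ⟨i', c.ι.app j ≫ h'⟩ := by
      intro j
      apply hinj
      have := H j
      simp only [← Category.assoc, ← f.map_comp] at this
      exact this
    obtain rfl : i = i' := congrArg Sigma.fst (H' (Classical.arbitrary J))
    have : h = h' := hc.hom_ext fun j => by
      have := H' j
      simpa only [Sigma.mk.injEq, heq_eq_eq, true_and] using this
    rw [this]
  choose m hm using ex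
  exact ⟨{ desc := m
           fac := hm
           uniq := fun s m' h => un _ _ _ fun j => (h j).trans (hm s j).symm }⟩
end

section
/- Let A be a locally small category having all finite colimits, let B be a locally small category, and let f : A ⥤ B be a functor such that for every object b of B the presheaf B(f(−), b) : Aᵒᵖ ⥤ Type v (that is, f.op ⋙ yoneda.obj b) is isomorphic to the colimit of a diagram G ⋙ yoneda for some small filtered category J and functor G : J ⥤ A. Then f preserves all finite colimits. -/
open CategoryTheory CategoryTheory.Limits

universe v u₁ u₂

/-- Comparison of the category of elements of `B(f(-), b)` with the comma category `f / b`. -/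
def pluriToCostr {A : Type u₁} {B : Type u₂} [Category.{v} A] [Category.{v} B] (f : A ⥤ B) (b : B) :
    CostructuredArrow yoneda (f.op ⋙ yoneda.obj b) ⥤ CostructuredArrow f b where
  obj X := CostructuredArrow.mk (Y := X.left)
    (show f.obj X.left ⟶ b from yonedaEquiv X.hom)
  map {X Y} g := CostructuredArrow.homMk g.left (by
    have h := CostructuredArrow.w g
    have h2 := yonedaEquiv_naturality Y.hom g.left
    rw [h] at h2
    exact h2)

theorem pluri_coflat_aux {A : Type u₁} {B : Type u₂} [Category.{v} A] [Category.{v} B] (f : A ⥤ B)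
    (b : B) (h : IsFiltered (CostructuredArrow yoneda (f.op ⋙ yoneda.obj b))) :
    IsFiltered (CostructuredArrow f b) := by
  have h1 : (pluriToCostr f b).Faithful := ⟨fun {X Y} g g' e => by
    apply CostructuredArrow.hom_ext
    have e2 : ((pluriToCostr f b).map g).left = ((pluriToCostr f b).map g').left := by rw [e]
    exact e2⟩
  have h2 : (pluriToCostr f b).Full := ⟨fun {X Y} g => by
    refine ⟨CostructuredArrow.homMk g.left ?_, ?_⟩
    · apply yonedaEquiv.injective
      have hw := CostructuredArrow.w g
      have h2 := yonedaEquiv_naturality Y.hom g.left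
      exact h2.symm.trans hw
    · apply CostructuredArrow.hom_ext
      rfl⟩
  have h3 : (pluriToCostr f b).EssSurj := ⟨fun X => by
    refine ⟨CostructuredArrow.mk (Y := X.left)
      (yonedaEquiv.symm (show (f.op ⋙ yoneda.obj b).obj (Opposite.op X.left) from X.hom)),
      ⟨CostructuredArrow.isoMk (Iso.refl _) ?_⟩⟩
    have := yonedaEquiv.apply_symm_apply
      (show (f.op ⋙ yoneda.obj b).obj (Opposite.op X.left) from X.hom)
    refine Eq.trans ?_ this.symm
    exact (congrArg (· ≫ X.hom) (f.map_id _)).trans (Category.id_comp _)⟩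
  have : (pluriToCostr f b).IsEquivalence := {}
  exact IsFiltered.of_equivalence (pluriToCostr f b).asEquivalence

/-- A left pluriadjoint functor (each presheaf `B(f(−), b)` is a small filtered colimit of
representables) from a category with all finite colimits preserves all finite colimits. -/
theorem pluriadjoint_preserves_finite_colimits {A : Type u₁} {B : Type u₂}
    [Category.{v} A] [Category.{v} B] [HasFiniteColimits A]
    (f : A ⥤ B)
    (hf : ∀ b : B, ∃ (J : Type v) (_ : SmallCategory J) (_ : IsFiltered J) (G : J ⥤ A),
      Nonempty ((f.op ⋙ yoneda.obj b) ≅ colimit (G ⋙ yoneda))) :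
    PreservesFiniteColimits f := by
  have : RepresentablyCoflat f := ⟨fun b => by
    obtain ⟨J, _, _, G, ⟨e⟩⟩ := hf b
    apply pluri_coflat_aux
    have hc : IsIndObject (colimit (G ⋙ yoneda)) :=
      IsIndObject.mk (IndObjectPresentation.ofCocone _ (colimit.isColimit (G ⋙ yoneda)))
    exact (hc.map e.inv).isFiltered⟩
  exact preservesFiniteColimits_of_coflat f
end
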